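/- arXiv:1903.06647 — 4 statements merged into one kernel-verified Lean document; each statement's English description precedes it below -/
import Mathlib

section
/- Define V* : X → ℝ by V*(x) = (d̄ + r) · Σ_{(a,s)∈A×S} (x̄_{a,s} − x_{a,s}) − c₀, where c₀ ∈ ℝ is an arbitrary fixed constant (interpreted as the delivery cost C(x̄) of the full order set). Then V* is a fixed point of the dynamic programming operator T, i.e. (T V*)(x) = V*(x) for every x ∈ X. -/
noncomputable section
open Finset Real Filter Topology Matrix

variable {abar sbar : ℕ}

/-- Unit vector `1_{a,s}` of coordinate `i = (a,s)`. -/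
def e (i : Fin abar × Fin sbar) : Fin abar × Fin sbar → ℤ := fun j => if j = i then 1 else 0

/-- The state space `X = {x : 0 ≤ x ≤ x̄}` (componentwise). -/
def Xset (xbar : Fin abar × Fin sbar → ℤ) : Finset (Fin abar × Fin sbar → ℤ) :=
  Finset.Icc 0 xbar

/-- The price set `D`. -/
def Dset (dlow dbar : ℝ) : Set (Fin abar × Fin sbar → ℝ) :=
  {d | ∀ i, dlow ≤ d i ∧ d i ≤ dbar}

/-- Multinomial logit choice probability `Π_{a,s}(d)`. -/
def mnl (βc βd : ℝ) (β : Fin sbar → ℝ) (d : Fin abar × Fin sbar → ℝ)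
    (a : Fin abar) (s : Fin sbar) : ℝ :=
  Real.exp (βc + β s + βd * d (a, s)) /
    ((∑ k, Real.exp (βc + β k + βd * d (a, k))) + 1)

/-- No-purchase probability `Π_{a,0}(d)`. -/
def mnl0 (βc βd : ℝ) (β : Fin sbar → ℝ) (d : Fin abar × Fin sbar → ℝ) (a : Fin abar) : ℝ :=
  1 / ((∑ k, Real.exp (βc + β k + βd * d (a, k))) + 1)

/-- Purchase probability `p_{a,s}(d) = λ pr(a) Π_{a,s}(d)`. -/
def prob (lam : ℝ) (pr : Fin abar → ℝ) (βc βd : ℝ) (β : Fin sbar → ℝ)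
    (d : Fin abar × Fin sbar → ℝ) (i : Fin abar × Fin sbar) : ℝ :=
  lam * pr i.1 * mnl βc βd β d i.1 i.2

/-- The pairs `(a,s)` that are feasible at `x`, i.e. such that `x + 1_{a,s} ∈ X`. -/
def feas (xbar : Fin abar × Fin sbar → ℤ) (x : Fin abar × Fin sbar → ℤ) :
    Finset (Fin abar × Fin sbar) :=
  Finset.univ.filter fun i => x + e i ∈ Xset xbar

/-- Objective of the dynamic-programming maximisation. -/
def obj (xbar : Fin abar × Fin sbar → ℤ) (lam : ℝ) (pr : Fin abar → ℝ) (βc βd : ℝ)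
    (β : Fin sbar → ℝ) (r : ℝ) (V : (Fin abar × Fin sbar → ℤ) → ℝ)
    (x : Fin abar × Fin sbar → ℤ) (d : Fin abar × Fin sbar → ℝ) : ℝ :=
  (∑ i ∈ feas xbar x, prob lam pr βc βd β d i * (r + d i + V (x + e i) - V x)) + V x

/-- The dynamic programming operator `T`. -/
def T (xbar : Fin abar × Fin sbar → ℤ) (dlow dbar lam : ℝ) (pr : Fin abar → ℝ)
    (βc βd : ℝ) (β : Fin sbar → ℝ) (r : ℝ)
    (V : (Fin abar × Fin sbar → ℤ) → ℝ) : (Fin abar × Fin sbar → ℤ) → ℝ :=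
  fun x => sSup {v | ∃ d ∈ Dset (abar := abar) (sbar := sbar) dlow dbar,
    v = obj xbar lam pr βc βd β r V x d}

/-- Transition probabilities `P_{x,y}(d)`. -/
def Ptrans (xbar : Fin abar × Fin sbar → ℤ) (lam : ℝ) (pr : Fin abar → ℝ) (βc βd : ℝ)
    (β : Fin sbar → ℝ) (x y : Fin abar × Fin sbar → ℤ)
    (d : Fin abar × Fin sbar → ℝ) : ℝ :=
  (if y = x then 1 - ∑ i ∈ feas xbar x, prob lam pr βc βd β d i else 0) +
    ∑ i ∈ feas xbar x, if y = x + e i then prob lam pr βc βd β d i else 0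

/-- `max_{d ∈ D} Σ_{y ∈ X} P_{x,y}(d) v(y)`. -/
def mstep (xbar : Fin abar × Fin sbar → ℤ) (dlow dbar lam : ℝ) (pr : Fin abar → ℝ)
    (βc βd : ℝ) (β : Fin sbar → ℝ) (v : (Fin abar × Fin sbar → ℤ) → ℝ)
    (x : Fin abar × Fin sbar → ℤ) : ℝ :=
  sSup {w | ∃ d ∈ Dset (abar := abar) (sbar := sbar) dlow dbar,
    w = ∑ y ∈ Xset xbar, Ptrans xbar lam pr βc βd β x y d * v y}

/-- `v` solves the auxiliary dynamic program. -/
def AuxDP (xbar : Fin abar × Fin sbar → ℤ) (dlow dbar lam : ℝ) (pr : Fin abar → ℝ)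
    (βc βd : ℝ) (β : Fin sbar → ℝ) (v : (Fin abar × Fin sbar → ℤ) → ℝ) : Prop :=
  v xbar = 1 ∧ ∀ x ∈ Xset xbar, x ≠ xbar →
    v x = 1 + mstep xbar dlow dbar lam pr βc βd β v x

/-- The modulus of contraction `ρ`. -/
def rho (xbar : Fin abar × Fin sbar → ℤ) (dlow dbar lam : ℝ) (pr : Fin abar → ℝ)
    (βc βd : ℝ) (β : Fin sbar → ℝ) (v : (Fin abar × Fin sbar → ℤ) → ℝ) : ℝ :=
  sSup {w | ∃ x ∈ Xset xbar, w = mstep xbar dlow dbar lam pr βc βd β v x / v x}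

/-- Weighted sup-norm `‖V‖ = max_{x ∈ X} |V(x)| / v(x)`. -/
def wnorm (xbar : Fin abar × Fin sbar → ℤ) (v V : (Fin abar × Fin sbar → ℤ) → ℝ) : ℝ :=
  sSup {w | ∃ x ∈ Xset xbar, w = |V x| / v x}

/-- The candidate fixed point `V*(x) = (d̄ + r) Σ (x̄ - x) - c₀`. -/
def Vstar (xbar : Fin abar × Fin sbar → ℤ) (dbar r c0 : ℝ) :
    (Fin abar × Fin sbar → ℤ) → ℝ :=
  fun x => (dbar + r) * ∑ i, ((xbar i - x i : ℤ) : ℝ) - c0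

/-- Concave extensibility of `f` on a set `Y` of integer points. -/
def ConcExt (Y : Set (Fin abar × Fin sbar → ℤ)) (f : (Fin abar × Fin sbar → ℤ) → ℝ) : Prop :=
  ∀ x ∈ Y, ∀ Q : Finset (Fin abar × Fin sbar → ℤ), ↑Q ⊆ Y →
    ∀ μ : (Fin abar × Fin sbar → ℤ) → ℝ,
      (∀ q ∈ Q, 0 ≤ μ q) → ∑ q ∈ Q, μ q = 1 →
      (∀ i, (x i : ℝ) = ∑ q ∈ Q, μ q * (q i : ℝ)) →
      ∑ q ∈ Q, μ q * f q ≤ f x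

/-- Joint concave extensibility of `g` on a set `Y` of mixed integer/real points. -/
def ConcExt2 (Y : Set ((Fin abar × Fin sbar → ℤ) × (Fin abar × Fin sbar → ℝ)))
    (g : (Fin abar × Fin sbar → ℤ) → (Fin abar × Fin sbar → ℝ) → ℝ) : Prop :=
  ∀ z ∈ Y, ∀ Q : Finset ((Fin abar × Fin sbar → ℤ) × (Fin abar × Fin sbar → ℝ)), ↑Q ⊆ Y →
    ∀ μ : ((Fin abar × Fin sbar → ℤ) × (Fin abar × Fin sbar → ℝ)) → ℝ,
      (∀ q ∈ Q, 0 ≤ μ q) → ∑ q ∈ Q, μ q = 1 →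
      (∀ i, (z.1 i : ℝ) = ∑ q ∈ Q, μ q * (q.1 i : ℝ)) →
      (∀ i, z.2 i = ∑ q ∈ Q, μ q * q.2 i) →
      ∑ q ∈ Q, μ q * g q.1 q.2 ≤ g z.1 z.2

/-- The set `P = {p(d) : d ∈ D}` of purchase-probability vectors. -/
def Pset (dlow dbar lam : ℝ) (pr : Fin abar → ℝ) (βc βd : ℝ) (β : Fin sbar → ℝ) :
    Set (Fin abar × Fin sbar → ℝ) :=
  {p | ∃ d ∈ Dset (abar := abar) (sbar := sbar) dlow dbar,
    p = fun i => prob lam pr βc βd β d i}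

/-- The expected continuation value `g(x,p)`. -/
def gfun (xbar : Fin abar × Fin sbar → ℤ) (V : (Fin abar × Fin sbar → ℤ) → ℝ)
    (x : Fin abar × Fin sbar → ℤ) (p : Fin abar × Fin sbar → ℝ) : ℝ :=
  (∑ i ∈ feas xbar x, p i * (V (x + e i) - V x)) + V x

/-- The logit choice probabilities are nonnegative. -/
theorem mnl_nonneg (βc βd : ℝ) (β : Fin sbar → ℝ) (d : Fin abar × Fin sbar → ℝ)
    (a : Fin abar) (s : Fin sbar) : 0 ≤ mnl βc βd β d a s := by
  unfold mnl
  positivity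

/-- The purchase probabilities are nonnegative. -/
theorem prob_nonneg {lam : ℝ} (hlam : 0 ≤ lam) {pr : Fin abar → ℝ} (hpr : ∀ a, 0 ≤ pr a)
    (βc βd : ℝ) (β : Fin sbar → ℝ) (d : Fin abar × Fin sbar → ℝ) (i : Fin abar × Fin sbar) :
    0 ≤ prob lam pr βc βd β d i :=
  mul_nonneg (mul_nonneg hlam (hpr i.1)) (mnl_nonneg βc βd β d i.1 i.2)

/-- Accepting one more order lowers `V*` by exactly `d̄ + r`. -/
theorem Vstar_add_e (xbar : Fin abar × Fin sbar → ℤ) (dbar r c0 : ℝ)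
    (x : Fin abar × Fin sbar → ℤ) (i : Fin abar × Fin sbar) :
    Vstar xbar dbar r c0 (x + e i) = Vstar xbar dbar r c0 x - (dbar + r) := by
  simp only [Vstar, e, Pi.add_apply, Int.cast_sub, Int.cast_add, Int.cast_ite, Int.cast_one,
    Int.cast_zero, Finset.sum_sub_distrib, Finset.sum_add_distrib, Finset.sum_ite_eq',
    Finset.mem_univ, if_true]
  ring

/-- With `V = V*`, each feasible order contributes its price deficit `d - d̄`. -/
theorem obj_Vstar (xbar : Fin abar × Fin sbar → ℤ) (lam : ℝ) (pr : Fin abar → ℝ) (βc βd : ℝ)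
    (β : Fin sbar → ℝ) (dbar r c0 : ℝ) (x : Fin abar × Fin sbar → ℤ)
    (d : Fin abar × Fin sbar → ℝ) :
    obj xbar lam pr βc βd β r (Vstar xbar dbar r c0) x d =
      (∑ i ∈ feas xbar x, prob lam pr βc βd β d i * (d i - dbar)) + Vstar xbar dbar r c0 x := by
  unfold obj
  congr 1
  refine Finset.sum_congr rfl fun i _ => ?_
  rw [Vstar_add_e]
  ring

/-- `V*(x) = (d̄ + r) Σ (x̄ - x) - c₀` is a fixed point of the DP
operator: for every `x ∈ X`, the maximum over `d ∈ D` of the DP objective (computed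
with `V = V*`) is attained and equals `V*(x)`, i.e. `(T V*)(x) = V*(x)`. -/
theorem vstar_is_fixed_point (abar sbar : ℕ) (xbar : Fin abar × Fin sbar → ℤ) (hxbar : ∀ i, 0 ≤ xbar i)
    (dlow dbar : ℝ) (hd : dlow ≤ dbar) (lam : ℝ) (hlam0 : 0 < lam) (hlam1 : lam < 1)
    (pr : Fin abar → ℝ) (hpr : ∀ a, 0 ≤ pr a ∧ pr a ≤ 1) (hprs : ∑ a, pr a = 1)
    (βc : ℝ) (β : Fin sbar → ℝ) (βd : ℝ) (hβd : βd < 0) (r : ℝ) (c0 : ℝ) :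
    ∀ x ∈ Xset xbar,
      IsGreatest
        {v | ∃ d ∈ Dset (abar := abar) (sbar := sbar) dlow dbar,
          v = obj xbar lam pr βc βd β r (Vstar xbar dbar r c0) x d}
        (Vstar xbar dbar r c0 x) := by
  intro x _
  refine ⟨⟨fun _ => dbar, fun _ => ⟨hd, le_rfl⟩, by simp [obj_Vstar]⟩, ?_⟩
  rintro _ ⟨d, hdD, rfl⟩
  rw [obj_Vstar]
  have hsum : ∑ i ∈ feas xbar x, prob lam pr βc βd β d i * (d i - dbar) ≤ 0 :=
    Finset.sum_nonpos fun i _ => mul_nonpos_of_nonneg_of_nonpos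
      (prob_nonneg hlam0.le (fun a => (hpr a).1) βc βd β d i) (sub_nonpos.mpr (hdD i).2)
  linarith
end
end

section
/- Fix n ≥ 1 and real parameters r, β_c, β_1, …, β_n, and β_d < 0. The function F : (0,∞)^{n+1} → ℝ defined by F(p_0, p_1, …, p_n) = Σ_{s=1}^n p_s ( r + β_d^{−1} [ ln(p_s / p_0) − β_c − β_s ] ) is concave on the open positive orthant (0,∞)^{n+1} (jointly in all n+1 variables). -/
noncomputable section
open Finset Real

/-- The tangent plane of `(x, y) ↦ x log (x / y)` at `(u, v)` lies below its graph. -/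
lemma mul_log_div_tangent_le {x y u v : ℝ} (hx : 0 < x) (hy : 0 < y) (hu : 0 < u) (hv : 0 < v) :
    x * Real.log (u / v) + x - y * (u / v) ≤ x * Real.log (x / y) := by
  have h := Real.log_le_sub_one_of_pos (div_pos (div_pos hu hv) (div_pos hx hy))
  rw [Real.log_div (div_pos hu hv).ne' (div_pos hx hy).ne'] at h
  have h2 := mul_le_mul_of_nonneg_left h hx.le
  have h3 : x * (u / v / (x / y) - 1) = y * (u / v) - x := by
    field_simp
  linarith

/-- The function `(x, y) ↦ x log (x / y)` is jointly convex on the open positive quadrant. -/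
lemma convexOn_mul_log_div :
    ConvexOn ℝ (Set.Ioi (0 : ℝ) ×ˢ Set.Ioi (0 : ℝ)) (fun q => q.1 * Real.log (q.1 / q.2)) := by
  have hconv := (convex_Ioi (𝕜 := ℝ) (0 : ℝ)).prod (convex_Ioi (𝕜 := ℝ) (0 : ℝ))
  refine ⟨hconv, ?_⟩
  rintro ⟨x, y⟩ hxy ⟨x', y'⟩ hxy' a b ha hb hab
  obtain ⟨hu, hv⟩ := hconv hxy hxy' ha hb hab
  obtain ⟨hx, hy⟩ := hxy
  obtain ⟨hx', hy'⟩ := hxy'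
  simp only [Prod.smul_mk, Prod.mk_add_mk, smul_eq_mul, Set.mem_Ioi] at *
  have h₁ := mul_le_mul_of_nonneg_left (mul_log_div_tangent_le hx hy hu hv) ha
  have h₂ := mul_le_mul_of_nonneg_left (mul_log_div_tangent_le hx' hy' hu hv) hb
  linear_combination h₁ + h₂ + mul_div_cancel₀ (a * x + b * x') hv.ne'

/-- The per-area expected-revenue function
`F(p₀, p₁, …, pₙ) = Σ_{s=1}^n p_s (r + βd⁻¹ [ln(p_s/p₀) − βc − β_s])`
(indices: `p 0` is `p₀`, `p s.succ` is `p_s` for `s = 1, …, n`) is concave on the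
open positive orthant `(0,∞)^{n+1}`, jointly in all `n+1` variables. -/
theorem per_area_revenue_concave (n : ℕ) (hn : 1 ≤ n) (r βc : ℝ) (β : Fin n → ℝ)
    (βd : ℝ) (hβd : βd < 0) :
    ConcaveOn ℝ {p : Fin (n + 1) → ℝ | ∀ i, 0 < p i}
      (fun p => ∑ s : Fin n,
        p s.succ * (r + βd⁻¹ * (Real.log (p s.succ / p 0) - βc - β s))) := by
  refine ⟨fun p hp q hq a b ha hb hab i =>
    convex_Ioi (0 : ℝ) (hp i) (hq i) ha hb hab, ?_⟩
  intro p hp q hq a b ha hb hab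
  simp only [smul_eq_mul, Finset.mul_sum, ← Finset.sum_add_distrib, Pi.add_apply, Pi.smul_apply]
  refine Finset.sum_le_sum fun s _ => ?_
  have h := convexOn_mul_log_div.2 (x := (p s.succ, p 0)) ⟨hp _, hp _⟩
    (y := (q s.succ, q 0)) ⟨hq _, hq _⟩ ha hb hab
  simp only [Prod.smul_mk, Prod.mk_add_mk, smul_eq_mul] at h
  linear_combination mul_le_mul_of_nonpos_left h (inv_lt_zero.2 hβd).le
end
end

section
/- The function f defined by f(p) = Σ_{a∈A} Σ_{s∈S} p_{a,s} { r + β_d^{−1} [ ln( p_{a,s} / (λ π(a) − Σ_{k∈S} p_{a,k}) ) − β_c − β_s ] } is concave on the open convex set { p ∈ ℝ^{A×S} : p_{a,s} > 0 for all (a,s), and Σ_{s∈S} p_{a,s} < λ π(a) for all a }. -/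
noncomputable section
open Finset Real

theorem convex_pos_sum_lt {ι : Type*} [Fintype ι] (c : ℝ) :
    Convex ℝ {x : ι → ℝ | (∀ i, 0 < x i) ∧ ∑ i, x i < c} := by
  rintro x ⟨hx, hxc⟩ y ⟨hy, hyc⟩ a b ha hb hab
  refine ⟨fun i => convex_Ioi (0 : ℝ) (hx i) (hy i) ha hb hab, ?_⟩
  have h := convex_Iio c hxc hyc ha hb hab
  simpa [Finset.sum_add_distrib, Finset.mul_sum] using h

/-- With the residual `q = c - ∑ i, x i`, the log-odds sum equals
`∑ i, x i * log (x i) + q * log q - c * log q`, a sum of convex terms. -/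
theorem sum_mul_log_div_residual {ι : Type*} [Fintype ι] {c : ℝ} {x : ι → ℝ}
    (hx : ∀ i, 0 < x i) (hxc : ∑ i, x i < c) :
    ∑ i, x i * Real.log (x i / (c - ∑ k, x k)) =
      ∑ i, x i * Real.log (x i) + (c - ∑ k, x k) * Real.log (c - ∑ k, x k)
        - c * Real.log (c - ∑ k, x k) := by
  have hq : c - ∑ k, x k ≠ 0 := (sub_pos.2 hxc).ne'
  simp_rw [fun i => Real.log_div (hx i).ne' hq, mul_sub, Finset.sum_sub_distrib,
    ← Finset.sum_mul]
  ring

theorem convexOn_sum_mul_log_div_residual {ι : Type*} [Fintype ι] {c : ℝ} (hc : 0 ≤ c) :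
    ConvexOn ℝ {x : ι → ℝ | (∀ i, 0 < x i) ∧ ∑ i, x i < c}
      (fun x => ∑ i, x i * Real.log (x i / (c - ∑ k, x k))) := by
  refine ⟨convex_pos_sum_lt c, ?_⟩
  intro x hx y hy a b ha hb hab
  have hz := convex_pos_sum_lt c hx hy ha hb hab
  have hqx : 0 < c - ∑ k, x k := sub_pos.2 hx.2
  have hqy : 0 < c - ∑ k, y k := sub_pos.2 hy.2
  have hq : c - ∑ k, (a • x + b • y) k = a * (c - ∑ k, x k) + b * (c - ∑ k, y k) := by
    simp only [Pi.add_apply, Pi.smul_apply, smul_eq_mul, Finset.sum_add_distrib,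
      ← Finset.mul_sum]
    linear_combination (-c) * hab
  have hentropy : ∑ i, (a • x + b • y) i * Real.log ((a • x + b • y) i) ≤
      a * ∑ i, x i * Real.log (x i) + b * ∑ i, y i * Real.log (y i) := by
    rw [Finset.mul_sum, Finset.mul_sum, ← Finset.sum_add_distrib]
    exact Finset.sum_le_sum fun i _ =>
      Real.convexOn_mul_log.2 (hx.1 i).le (hy.1 i).le ha hb hab
  have hres := Real.convexOn_mul_log.2 hqx.le hqy.le ha hb hab
  have hlog := mul_le_mul_of_nonneg_left
    (strictConcaveOn_log_Ioi.concaveOn.2 hqx hqy ha hb hab) hc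
  simp only [smul_eq_mul] at hres hlog ⊢
  rw [sum_mul_log_div_residual hz.1 hz.2, sum_mul_log_div_residual hx.1 hx.2,
    sum_mul_log_div_residual hy.1 hy.2, hq]
  linarith

/-- The expected-revenue function
`f(p) = Σ_a Σ_s p_{a,s} { r + βd⁻¹ [ ln( p_{a,s} / (λπ(a) − Σ_k p_{a,k}) ) − βc − β_s ] }`
is concave on the open convex set
`{ p : p_{a,s} > 0 for all (a,s), Σ_s p_{a,s} < λπ(a) for all a }`. -/
theorem revenue_term_concave (abar sbar : ℕ) (lam : ℝ) (hlam0 : 0 < lam) (hlam1 : lam < 1)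
    (pr : Fin abar → ℝ) (hpr : ∀ a, 0 < pr a ∧ pr a ≤ 1) (hprs : ∑ a, pr a = 1)
    (βc : ℝ) (β : Fin sbar → ℝ) (βd : ℝ) (hβd : βd < 0) (r : ℝ) :
    ConcaveOn ℝ
      {p : Fin abar × Fin sbar → ℝ |
        (∀ i, 0 < p i) ∧ ∀ a, (∑ s, p (a, s)) < lam * pr a}
      (fun p => ∑ a, ∑ s, p (a, s) *
        (r + βd⁻¹ *
          (Real.log (p (a, s) / (lam * pr a - ∑ k, p (a, k))) - βc - β s))) := by
  have hset : Convex ℝ {p : Fin abar × Fin sbar → ℝ |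
      (∀ i, 0 < p i) ∧ ∀ a, (∑ s, p (a, s)) < lam * pr a} := by
    rintro x ⟨hx, hxc⟩ y ⟨hy, hyc⟩ t u ht hu htu
    exact ⟨fun i => convex_Ioi (0 : ℝ) (hx i) (hy i) ht hu htu, fun a =>
      (convex_pos_sum_lt (lam * pr a) (x := fun s => x (a, s)) ⟨fun s => hx (a, s), hxc a⟩
        (y := fun s => y (a, s)) ⟨fun s => hy (a, s), hyc a⟩ ht hu htu).2⟩
  refine ⟨hset, ?_⟩
  rintro x ⟨hx, hxc⟩ y ⟨hy, hyc⟩ t u ht hu htu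
  have hsplit (p : Fin abar × Fin sbar → ℝ) (a : Fin abar) :
      ∑ s, p (a, s) * (r + βd⁻¹ *
          (Real.log (p (a, s) / (lam * pr a - ∑ k, p (a, k))) - βc - β s)) =
        ∑ s, p (a, s) * (r - βd⁻¹ * (βc + β s)) +
          βd⁻¹ * ∑ s, p (a, s) * Real.log (p (a, s) / (lam * pr a - ∑ k, p (a, k))) := by
    rw [Finset.mul_sum, ← Finset.sum_add_distrib]
    exact Finset.sum_congr rfl fun s _ => by ring
  simp only [smul_eq_mul, hsplit]
  rw [Finset.mul_sum, Finset.mul_sum, ← Finset.sum_add_distrib]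
  refine Finset.sum_le_sum fun a _ => ?_
  have hconv := (convexOn_sum_mul_log_div_residual (mul_pos hlam0 (hpr a).1).le).2
    (x := fun s => x (a, s)) ⟨fun s => hx (a, s), hxc a⟩
    (y := fun s => y (a, s)) ⟨fun s => hy (a, s), hyc a⟩ ht hu htu
  have hscaled := mul_le_mul_of_nonpos_left hconv (inv_lt_zero.2 hβd).le
  have hlin : ∑ s, (t • x + u • y) (a, s) * (r - βd⁻¹ * (βc + β s)) =
      t * ∑ s, x (a, s) * (r - βd⁻¹ * (βc + β s)) +
        u * ∑ s, y (a, s) * (r - βd⁻¹ * (βc + β s)) := by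
    rw [Finset.mul_sum, Finset.mul_sum, ← Finset.sum_add_distrib]
    exact Finset.sum_congr rfl fun s _ => by
      simp only [Pi.add_apply, Pi.smul_apply, smul_eq_mul]
      ring
  rw [hlin]
  simp only [Pi.add_apply, Pi.smul_apply, smul_eq_mul] at hscaled ⊢
  linarith
end
end

section
/- Let V : ℤ^{A×S} → ℝ, let x ∈ ℤ^{A×S}, let Q be a finite index set with weights μ_q ≥ 0, Σ_{q∈Q} μ_q = 1, and let points (q^{(x)}, q^{(p)}) ∈ ℤ^{A×S} × ℝ_{≥0}^{A×S} and p ∈ ℝ_{≥0}^{A×S} satisfy x = Σ_q μ_q q^{(x)} and p = Σ_q μ_q q^{(p)}. Suppose ε := V(x) − Σ_q μ_q V(q^{(x)}) > 0. Define w := min_{(a,s)∈A×S} [ V(x+1_{a,s}) − V(x) ] and W := max_{q∈Q, (a,s)∈A×S} [ V(q^{(x)}+1_{a,s}) − V(q^{(x)}) ]. If (W − w) · Σ_{(a,s)} p_{a,s} ≤ ε (equivalently, writing p_{a,s} = λ π(a) Π_{a,s}, if λ ≤ ε / ( (W − w) Σ_{(a,s)} π(a) Π_{a,s} ) when W > w),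 then Σ_{(a,s)} p_{a,s} [ V(x+1_{a,s}) − V(x) ] + V(x) ≥ Σ_{q∈Q} μ_q { Σ_{(a,s)} q^{(p)}_{a,s} [ V(q^{(x)}+1_{a,s}) − V(q^{(x)}) ] + V(q^{(x)}) }, i.e. the concave-extensibility inequality for g(x,p) := Σ_{(a,s)} p_{a,s} [ V(x+1_{a,s}) − V(x) ] + V(x) holds at (x,p) for this enclosing set. -/
noncomputable section
open Finset Real Filter Topology Matrix

variable {abar sbar : ℕ}

/-- Strict-gap case of concave extensibility of
`g(x,p) = Σ_{(a,s)} p_{a,s}[V(x+1_{a,s}) − V(x)] + V(x)`: if the concavity gap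
`ε = V(x) − Σ_q μ_q V(q^{(x)})` is positive and `(W − w)·Σ_{(a,s)} p_{a,s} ≤ ε`
(which holds for small enough arrival rate `λ`), where `w` is the minimum of
`V(x+1_{a,s}) − V(x)` and `W` the maximum of `V(q^{(x)}+1_{a,s}) − V(q^{(x)})`, then
the concave-extensibility inequality for `g` holds at `(x,p)` for this enclosing set. -/
theorem g_concave_extensible_of_strict_gap (abar sbar : ℕ) (ha : 0 < abar) (hs : 0 < sbar)
    (V : (Fin abar × Fin sbar → ℤ) → ℝ) (x : Fin abar × Fin sbar → ℤ)
    (κ : Type) (Q : Finset κ) (μ : κ → ℝ)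
    (qx : κ → Fin abar × Fin sbar → ℤ) (qp : κ → Fin abar × Fin sbar → ℝ)
    (p : Fin abar × Fin sbar → ℝ)
    (hμ : ∀ q ∈ Q, 0 ≤ μ q) (hμ1 : ∑ q ∈ Q, μ q = 1)
    (hqp : ∀ q ∈ Q, ∀ i, 0 ≤ qp q i) (hp : ∀ i, 0 ≤ p i)
    (hx : ∀ i, (x i : ℝ) = ∑ q ∈ Q, μ q * (qx q i : ℝ))
    (hpc : ∀ i, p i = ∑ q ∈ Q, μ q * qp q i)
    (ε : ℝ) (hε : ε = V x - ∑ q ∈ Q, μ q * V (qx q)) (hεpos : 0 < ε)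
    (w W : ℝ)
    (hw : IsLeast {v | ∃ i : Fin abar × Fin sbar, v = V (x + e i) - V x} w)
    (hW : IsGreatest
      {v | ∃ q ∈ Q, ∃ i : Fin abar × Fin sbar, v = V (qx q + e i) - V (qx q)} W)
    (hkey : (W - w) * ∑ i, p i ≤ ε) :
    ∑ q ∈ Q, μ q * ((∑ i, qp q i * (V (qx q + e i) - V (qx q))) + V (qx q)) ≤
      (∑ i, p i * (V (x + e i) - V x)) + V x := by
  have upper : ∑ q ∈ Q, μ q * ∑ i, qp q i * (V (qx q + e i) - V (qx q)) ≤ W * ∑ i, p i := by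
    calc ∑ q ∈ Q, μ q * ∑ i, qp q i * (V (qx q + e i) - V (qx q))
        ≤ ∑ q ∈ Q, μ q * ∑ i, qp q i * W := by
          refine Finset.sum_le_sum fun q hq => mul_le_mul_of_nonneg_left ?_ (hμ q hq)
          exact Finset.sum_le_sum fun i _ =>
            mul_le_mul_of_nonneg_left (hW.2 ⟨q, hq, i, rfl⟩) (hqp q hq i)
      _ = W * ∑ i, p i := by
          simp_rw [hpc, Finset.mul_sum]
          rw [Finset.sum_comm]
          exact Finset.sum_congr rfl fun i _ => Finset.sum_congr rfl fun q _ => by ring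
  have lower : w * ∑ i, p i ≤ ∑ i, p i * (V (x + e i) - V x) := by
    rw [Finset.mul_sum]
    refine Finset.sum_le_sum fun i _ => ?_
    rw [mul_comm]
    exact mul_le_mul_of_nonneg_left (hw.2 ⟨i, rfl⟩) (hp i)
  simp_rw [mul_add, Finset.sum_add_distrib]
  linarith
end
end
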